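/- arXiv:math/0610896 — 3 statements merged into one kernel-verified Lean document; each statement's English description precedes it below -/
import Mathlib

section
/- If q is not a root of unity, the center of U_q(f_m(K)) equals C[Ω], the subalgebra generated by the Casimir element Ω; in particular the center is isomorphic to a polynomial ring in one variable. -/
noncomputable section

inductive UqGen : Type
  | E : UqGen
  | F : UqGen
  | K : UqGen
  | Kinv : UqGen

def lpow {A : Type*} [Monoid A] (x xinv : A) (n : ℤ) : A :=
  if 0 ≤ n then x ^ n.toNat else xinv ^ (-n).toNat

open FreeAlgebra in
inductive UqRel (q : ℂ) (m : ℕ) : FreeAlgebra ℂ UqGen → FreeAlgebra ℂ UqGen → Prop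
  | KE : UqRel q m (ι ℂ UqGen.K * ι ℂ UqGen.E) (q ^ 2 • (ι ℂ UqGen.E * ι ℂ UqGen.K))
  | KF : UqRel q m (ι ℂ UqGen.K * ι ℂ UqGen.F) ((q ^ 2)⁻¹ • (ι ℂ UqGen.F * ι ℂ UqGen.K))
  | KKinv : UqRel q m (ι ℂ UqGen.K * ι ℂ UqGen.Kinv) 1
  | KinvK : UqRel q m (ι ℂ UqGen.Kinv * ι ℂ UqGen.K) 1
  | EF : UqRel q m (ι ℂ UqGen.E * ι ℂ UqGen.F - ι ℂ UqGen.F * ι ℂ UqGen.E)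
      ((q - q⁻¹)⁻¹ • ((ι ℂ UqGen.K) ^ m - (ι ℂ UqGen.Kinv) ^ m))

abbrev Uq (q : ℂ) (m : ℕ) : Type := RingQuot (UqRel q m)

def Egen (q : ℂ) (m : ℕ) : Uq q m := RingQuot.mkAlgHom ℂ (UqRel q m) (FreeAlgebra.ι ℂ UqGen.E)
def Fgen (q : ℂ) (m : ℕ) : Uq q m := RingQuot.mkAlgHom ℂ (UqRel q m) (FreeAlgebra.ι ℂ UqGen.F)
def Kgen (q : ℂ) (m : ℕ) : Uq q m := RingQuot.mkAlgHom ℂ (UqRel q m) (FreeAlgebra.ι ℂ UqGen.K)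
def Kinvgen (q : ℂ) (m : ℕ) : Uq q m := RingQuot.mkAlgHom ℂ (UqRel q m) (FreeAlgebra.ι ℂ UqGen.Kinv)

def Kzpow (q : ℂ) (m : ℕ) (n : ℤ) : Uq q m := lpow (Kgen q m) (Kinvgen q m) n

def Casimir (q : ℂ) (m : ℕ) : Uq q m :=
  Fgen q m * Egen q m +
    (((q ^ (2 * m) - 1) * (q - q⁻¹))⁻¹ * q ^ (2 * m)) • Kgen q m ^ m +
    ((q ^ (2 * m) - 1) * (q - q⁻¹))⁻¹ • Kinvgen q m ^ m


section Relations

variable {q : ℂ} {m : ℕ}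

lemma Kgen_mul_Egen : Kgen q m * Egen q m = q ^ 2 • (Egen q m * Kgen q m) := by
  simpa [Kgen, Egen] using RingQuot.mkAlgHom_rel ℂ (UqRel.KE (q := q) (m := m))

lemma Kgen_mul_Fgen : Kgen q m * Fgen q m = (q ^ 2)⁻¹ • (Fgen q m * Kgen q m) := by
  simpa [Kgen, Fgen] using RingQuot.mkAlgHom_rel ℂ (UqRel.KF (q := q) (m := m))

lemma Kgen_mul_Kinvgen : Kgen q m * Kinvgen q m = 1 := by
  simpa [Kgen, Kinvgen] using RingQuot.mkAlgHom_rel ℂ (UqRel.KKinv (q := q) (m := m))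

lemma Kinvgen_mul_Kgen : Kinvgen q m * Kgen q m = 1 := by
  simpa [Kgen, Kinvgen] using RingQuot.mkAlgHom_rel ℂ (UqRel.KinvK (q := q) (m := m))

lemma Egen_mul_Fgen_sub : Egen q m * Fgen q m - Fgen q m * Egen q m =
    (q - q⁻¹)⁻¹ • (Kgen q m ^ m - Kinvgen q m ^ m) := by
  simpa [Kgen, Kinvgen, Egen, Fgen] using RingQuot.mkAlgHom_rel ℂ (UqRel.EF (q := q) (m := m))

end Relations

/-- The invertible element `K` as a unit. -/
def Kunit (q : ℂ) (m : ℕ) : (Uq q m)ˣ :=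
  ⟨Kgen q m, Kinvgen q m, Kgen_mul_Kinvgen, Kinvgen_mul_Kgen⟩

lemma Kunit_val (q : ℂ) (m : ℕ) : (Kunit q m : Uq q m) = Kgen q m := rfl

lemma Kunit_inv_val (q : ℂ) (m : ℕ) : ((Kunit q m)⁻¹ : (Uq q m)ˣ) = Kinvgen q m := rfl

lemma units_zpow_mul_of_smul_comm {A : Type*} [Ring A] [Algebra ℂ A] {u : Aˣ} {x : A} {c : ℂ}
    (hc : c ≠ 0) (h : u * x = c • (x * u)) (i : ℤ) :
    ((u ^ i : Aˣ) : A) * x = c ^ i • (x * ((u ^ i : Aˣ) : A)) := by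
  have hinv : ((u⁻¹ : Aˣ) : A) * x = c⁻¹ • (x * ((u⁻¹ : Aˣ) : A)) := by
    have h1 : ((u⁻¹ : Aˣ) : A) * (u * x) * ((u⁻¹ : Aˣ) : A) =
        ((u⁻¹ : Aˣ) : A) * (c • (x * u)) * ((u⁻¹ : Aˣ) : A) := by rw [h]
    simp only [Units.inv_mul_cancel_left, mul_smul_comm, smul_mul_assoc, mul_assoc,
      Units.mul_inv, mul_one] at h1
    rw [h1, smul_smul, inv_mul_cancel₀ hc, one_smul]
  induction i with
  | zero => simp
  | succ n ih =>
    rw [zpow_add_one, zpow_add_one₀ hc, Units.val_mul, mul_assoc, h, mul_smul_comm, ← mul_assoc,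
      ih, smul_mul_assoc, smul_smul, mul_assoc, mul_comm c]
  | pred n ih =>
    rw [zpow_sub_one, zpow_sub_one₀ hc, Units.val_mul, mul_assoc, hinv, mul_smul_comm,
      ← mul_assoc, ih, smul_mul_assoc, smul_smul, mul_assoc, mul_comm c⁻¹]

section Casimir

variable {q : ℂ} {m : ℕ}

lemma Kunit_zpow_mul_Egen (hq0 : q ≠ 0) (i : ℤ) :
    ((Kunit q m ^ i : (Uq q m)ˣ) : Uq q m) * Egen q m =
      (q ^ 2) ^ i • (Egen q m * ((Kunit q m ^ i : (Uq q m)ˣ) : Uq q m)) :=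
  units_zpow_mul_of_smul_comm (pow_ne_zero 2 hq0) Kgen_mul_Egen i

lemma Kunit_zpow_mul_Fgen (hq0 : q ≠ 0) (i : ℤ) :
    ((Kunit q m ^ i : (Uq q m)ˣ) : Uq q m) * Fgen q m =
      ((q ^ 2)⁻¹) ^ i • (Fgen q m * ((Kunit q m ^ i : (Uq q m)ˣ) : Uq q m)) :=
  units_zpow_mul_of_smul_comm (inv_ne_zero (pow_ne_zero 2 hq0)) Kgen_mul_Fgen i

lemma Kgen_pow_eq (n : ℕ) : Kgen q m ^ n = ((Kunit q m ^ (n : ℤ) : (Uq q m)ˣ) : Uq q m) := by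
  simp [Kunit_val]

lemma Kinvgen_pow_eq (n : ℕ) :
    Kinvgen q m ^ n = ((Kunit q m ^ (-(n : ℤ)) : (Uq q m)ˣ) : Uq q m) := by
  rw [zpow_neg, ← inv_zpow, zpow_natCast, Units.val_pow_eq_pow_val, Kunit_inv_val]

lemma Fgen_mul_Egen : Fgen q m * Egen q m = Casimir q m -
    ((((q ^ (2 * m) - 1) * (q - q⁻¹))⁻¹ * q ^ (2 * m)) • Kgen q m ^ m +
      ((q ^ (2 * m) - 1) * (q - q⁻¹))⁻¹ • Kinvgen q m ^ m) := by
  rw [Casimir]; abel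

lemma Egen_mul_Fgen (h1 : q ^ (2 * m) - 1 ≠ 0) :
    Egen q m * Fgen q m = Casimir q m -
    (((q ^ (2 * m) - 1) * (q - q⁻¹))⁻¹ • Kgen q m ^ m +
      (((q ^ (2 * m) - 1) * (q - q⁻¹))⁻¹ * q ^ (2 * m)) • Kinvgen q m ^ m) := by
  rw [sub_eq_iff_eq_add.1 (Egen_mul_Fgen_sub (q := q) (m := m)), Fgen_mul_Egen]
  have h : (q - q⁻¹)⁻¹ = ((q ^ (2 * m) - 1) * (q - q⁻¹))⁻¹ * (q ^ (2 * m) - 1) := by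
    rw [mul_inv]; field_simp
  rw [h]
  module

lemma Casimir_mul_Egen (hq0 : q ≠ 0) (h1 : q ^ (2 * m) - 1 ≠ 0) :
    Casimir q m * Egen q m = Egen q m * Casimir q m := by
  have hE := sub_eq_iff_eq_add.1 (Egen_mul_Fgen h1).symm
  have hF := sub_eq_iff_eq_add.1 (Fgen_mul_Egen (q := q) (m := m)).symm
  conv_lhs => rw [hE]
  conv_rhs => rw [hF]
  rw [Kgen_pow_eq, Kinvgen_pow_eq]
  simp only [add_mul, mul_add, mul_assoc, smul_mul_assoc, mul_smul_comm,
    Kunit_zpow_mul_Egen hq0, smul_smul]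
  have e : (q ^ 2) ^ (m : ℤ) = q ^ (2 * m) := by rw [zpow_natCast, pow_mul]
  have hne : q ^ (2 * m) ≠ 0 := pow_ne_zero _ hq0
  rw [zpow_neg, e, mul_inv_cancel₀ hne, mul_one]

lemma Casimir_mul_Fgen (hq0 : q ≠ 0) (h1 : q ^ (2 * m) - 1 ≠ 0) :
    Casimir q m * Fgen q m = Fgen q m * Casimir q m := by
  have hE := sub_eq_iff_eq_add.1 (Egen_mul_Fgen h1).symm
  have hF := sub_eq_iff_eq_add.1 (Fgen_mul_Egen (q := q) (m := m)).symm
  conv_lhs => rw [hF]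
  conv_rhs => rw [hE]
  rw [Kgen_pow_eq, Kinvgen_pow_eq]
  simp only [add_mul, mul_add, mul_assoc, smul_mul_assoc, mul_smul_comm,
    Kunit_zpow_mul_Fgen hq0, smul_smul]
  have e : (q ^ 2) ^ (m : ℤ) = q ^ (2 * m) := by rw [zpow_natCast, pow_mul]
  have hne : q ^ (2 * m) ≠ 0 := pow_ne_zero _ hq0
  rw [zpow_neg, inv_zpow, inv_inv, e, mul_inv_cancel₀ hne, mul_one]

lemma Casimir_mul_Kgen (hq0 : q ≠ 0) :
    Casimir q m * Kgen q m = Kgen q m * Casimir q m := by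
  have h : Kgen q m * (Fgen q m * Egen q m) = Fgen q m * Egen q m * Kgen q m := by
    rw [← mul_assoc, Kgen_mul_Fgen, smul_mul_assoc, mul_assoc, Kgen_mul_Egen, mul_smul_comm,
      smul_smul, inv_mul_cancel₀ (pow_ne_zero 2 hq0), one_smul, mul_assoc]
  have hK : Commute (Kgen q m) (Kinvgen q m ^ m) :=
    Commute.pow_right (Kgen_mul_Kinvgen.trans Kinvgen_mul_Kgen.symm) m
  rw [Casimir]
  simp only [add_mul, mul_add, smul_mul_assoc, mul_smul_comm, h, hK.eq, pow_mul_comm']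

/-- Left multiplication by generators suffices to reach all of `Uq q m`. -/
lemma Uq_submodule_eq_top {S : Submodule ℂ (Uq q m)} (h1 : 1 ∈ S)
    (hE : ∀ x ∈ S, Egen q m * x ∈ S) (hF : ∀ x ∈ S, Fgen q m * x ∈ S)
    (hK : ∀ x ∈ S, Kgen q m * x ∈ S) (hKi : ∀ x ∈ S, Kinvgen q m * x ∈ S) : S = ⊤ := by
  have key : ∀ a : FreeAlgebra ℂ UqGen, ∀ x ∈ S, RingQuot.mkAlgHom ℂ (UqRel q m) a * x ∈ S := by
    intro a
    induction a using FreeAlgebra.induction with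
    | grade0 r =>
      intro x hx
      rw [AlgHom.commutes, ← Algebra.smul_def]
      exact S.smul_mem r hx
    | grade1 g =>
      cases g
      exacts [hE, hF, hK, hKi]
    | mul a b ha hb =>
      intro x hx
      rw [map_mul, mul_assoc]
      exact ha _ (hb _ hx)
    | add a b ha hb =>
      intro x hx
      rw [map_add, add_mul]
      exact S.add_mem (ha _ hx) (hb _ hx)
  refine eq_top_iff.2 fun y _ => ?_
  obtain ⟨a, rfl⟩ := RingQuot.mkAlgHom_surjective ℂ (UqRel q m) y
  simpa using key a 1 h1

lemma Casimir_mem_center (hq0 : q ≠ 0) (h1 : q ^ (2 * m) - 1 ≠ 0) :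
    Casimir q m ∈ Subalgebra.center ℂ (Uq q m) := by
  have hK : Commute (Casimir q m) (Kunit q m : Uq q m) := Casimir_mul_Kgen hq0
  have step : ∀ g : Uq q m, Casimir q m * g = g * Casimir q m →
      ∀ x ∈ Subalgebra.toSubmodule (Subalgebra.centralizer ℂ {Casimir q m}),
        g * x ∈ Subalgebra.toSubmodule (Subalgebra.centralizer ℂ {Casimir q m}) := by
    intro g hg x hx
    refine mul_mem (S := Subalgebra ℂ (Uq q m)) ?_ hx
    simpa [Subalgebra.mem_centralizer_iff] using hg
  have htop := Uq_submodule_eq_top (one_mem (Subalgebra.centralizer ℂ {Casimir q m}))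
    (step _ (Casimir_mul_Egen hq0 h1)) (step _ (Casimir_mul_Fgen hq0 h1))
    (step _ (Casimir_mul_Kgen hq0)) (step _ hK.units_inv_right.eq)
  rw [Subalgebra.mem_center_iff]
  intro b
  have hb : b ∈ Subalgebra.toSubmodule (Subalgebra.centralizer ℂ {Casimir q m}) :=
    htop ▸ Submodule.mem_top
  exact ((Subalgebra.mem_centralizer_iff ℂ).1 hb _ rfl).symm

end Casimir

/-- The linear map sending a finitely supported family of polynomials `p i` to
`∑ i, K ^ i * p i (Ω)`. -/
def weightZero (q : ℂ) (m : ℕ) : (ℤ →₀ Polynomial ℂ) →ₗ[ℂ] Uq q m :=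
  Finsupp.lsum ℂ fun i : ℤ =>
    (LinearMap.mulLeft ℂ ((Kunit q m ^ i : (Uq q m)ˣ) : Uq q m)).comp
      (Polynomial.aeval (Casimir q m)).toLinearMap

section Decomposition

variable {q : ℂ} {m : ℕ}

lemma weightZero_single (i : ℤ) (p : Polynomial ℂ) :
    weightZero q m (Finsupp.single i p) =
      ((Kunit q m ^ i : (Uq q m)ˣ) : Uq q m) * Polynomial.aeval (Casimir q m) p := by
  simp [weightZero]

lemma aeval_mem_of_mem {A : Type*} [Ring A] [Algebra ℂ A] {S : Subalgebra ℂ A} {x : A}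
    (hx : x ∈ S) (p : Polynomial ℂ) : Polynomial.aeval x p ∈ S :=
  Algebra.adjoin_le (Set.singleton_subset_iff.2 hx)
    (Polynomial.aeval_mem_adjoin_singleton ℂ x)

/-- An element which scales past every `K ^ i` and commutes with `Ω` moves past the
weight zero part. -/
lemma mul_weightZero_mem {x : Uq q m} {c : ℤ → ℂ} (hc : ∀ i, c i ≠ 0)
    (hx : ∀ i : ℤ, ((Kunit q m ^ i : (Uq q m)ˣ) : Uq q m) * x =
      c i • (x * ((Kunit q m ^ i : (Uq q m)ˣ) : Uq q m)))
    (hΩ : Casimir q m ∈ Subalgebra.center ℂ (Uq q m)) (p : ℤ →₀ Polynomial ℂ) :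
    ∃ p', x * weightZero q m p = weightZero q m p' * x := by
  induction p using Finsupp.induction_linear with
  | zero => exact ⟨0, by simp⟩
  | add f g hf hg =>
    obtain ⟨f', hf⟩ := hf
    obtain ⟨g', hg⟩ := hg
    exact ⟨f' + g', by rw [map_add, map_add, mul_add, add_mul, hf, hg]⟩
  | single i p =>
    refine ⟨(c i)⁻¹ • Finsupp.single i p, ?_⟩
    have hp := aeval_mem_of_mem hΩ p
    rw [map_smul, weightZero_single, smul_mul_assoc, mul_assoc,
      ← Subalgebra.mem_center_iff.1 hp x, ← mul_assoc _ x, hx, smul_mul_assoc, smul_smul,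
      inv_mul_cancel₀ (hc i), one_smul, mul_assoc]

lemma weightZero_mul (hΩ : Casimir q m ∈ Subalgebra.center ℂ (Uq q m))
    (p p' : ℤ →₀ Polynomial ℂ) :
    ∃ r, weightZero q m p * weightZero q m p' = weightZero q m r := by
  induction p using Finsupp.induction_linear with
  | zero => exact ⟨0, by simp⟩
  | add f g hf hg =>
    obtain ⟨f', hf⟩ := hf
    obtain ⟨g', hg⟩ := hg
    exact ⟨f' + g', by rw [map_add, map_add, add_mul, hf, hg]⟩
  | single i p =>
    induction p' using Finsupp.induction_linear with
    | zero => exact ⟨0, by simp⟩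
    | add f g hf hg =>
      obtain ⟨f', hf⟩ := hf
      obtain ⟨g', hg⟩ := hg
      exact ⟨f' + g', by rw [map_add, map_add, mul_add, hf, hg]⟩
    | single j p' =>
      refine ⟨Finsupp.single (i + j) (p * p'), ?_⟩
      have hp := aeval_mem_of_mem hΩ p
      rw [weightZero_single, weightZero_single, weightZero_single, map_mul, zpow_add,
        Units.val_mul, mul_assoc, ← mul_assoc (Polynomial.aeval (Casimir q m) p),
        ← Subalgebra.mem_center_iff.1 hp]
      simp only [mul_assoc]

lemma Kunit_zpow_mem (i : ℤ) :
    ((Kunit q m ^ i : (Uq q m)ˣ) : Uq q m) ∈ LinearMap.range (weightZero q m) :=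
  ⟨Finsupp.single i 1, by simp [weightZero_single]⟩

lemma Casimir_mem_range : Casimir q m ∈ LinearMap.range (weightZero q m) :=
  ⟨Finsupp.single 0 Polynomial.X, by simp [weightZero_single]⟩

lemma Fgen_mul_Egen_mem : Fgen q m * Egen q m ∈ LinearMap.range (weightZero q m) := by
  rw [Fgen_mul_Egen, Kgen_pow_eq, Kinvgen_pow_eq]
  exact sub_mem Casimir_mem_range (add_mem (Submodule.smul_mem _ _ (Kunit_zpow_mem _))
    (Submodule.smul_mem _ _ (Kunit_zpow_mem _)))

lemma Egen_mul_Fgen_mem (h1 : q ^ (2 * m) - 1 ≠ 0) :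
    Egen q m * Fgen q m ∈ LinearMap.range (weightZero q m) := by
  rw [Egen_mul_Fgen h1, Kgen_pow_eq, Kinvgen_pow_eq]
  exact sub_mem Casimir_mem_range (add_mem (Submodule.smul_mem _ _ (Kunit_zpow_mem _))
    (Submodule.smul_mem _ _ (Kunit_zpow_mem _)))

/-- Triangular decomposition: `Uq q m` is spanned by the elements `r * E ^ n` and `r * F ^ n`
with `r` of weight zero generated by `K`, `K⁻¹` and `Ω`. -/
lemma span_weight_eq_top (hq0 : q ≠ 0) (h1 : q ^ (2 * m) - 1 ≠ 0) :
    Submodule.span ℂ {x | ∃ p, ∃ n : ℕ, x = weightZero q m p * Egen q m ^ n ∨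
      x = weightZero q m p * Fgen q m ^ n} = ⊤ := by
  have hΩ := Casimir_mem_center hq0 h1
  set T : Set (Uq q m) := {x | ∃ p, ∃ n : ℕ, x = weightZero q m p * Egen q m ^ n ∨
      x = weightZero q m p * Fgen q m ^ n} with hT
  have lift : ∀ g : Uq q m, (∀ x ∈ T, g * x ∈ T) →
      ∀ x ∈ Submodule.span ℂ T, g * x ∈ Submodule.span ℂ T := by
    intro g hg x hx
    induction hx using Submodule.span_induction with
    | mem x hx => exact Submodule.subset_span (hg x hx)
    | zero => simp
    | add x y _ _ hx hy => rw [mul_add]; exact add_mem hx hy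
    | smul a x _ hx => rw [mul_smul_comm]; exact Submodule.smul_mem _ _ hx
  have hw : ∀ g ∈ LinearMap.range (weightZero q m), ∀ x ∈ T, g * x ∈ T := by
    rintro _ ⟨p', rfl⟩ x ⟨p, n, rfl | rfl⟩
    · obtain ⟨r, hr⟩ := weightZero_mul hΩ p' p
      exact ⟨r, n, Or.inl (by rw [← mul_assoc, hr])⟩
    · obtain ⟨r, hr⟩ := weightZero_mul hΩ p' p
      exact ⟨r, n, Or.inr (by rw [← mul_assoc, hr])⟩
  have h2 : q ^ 2 ≠ 0 := pow_ne_zero 2 hq0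
  have hmE := mul_weightZero_mem (fun i => zpow_ne_zero i h2) (Kunit_zpow_mul_Egen hq0) hΩ
  have hmF := mul_weightZero_mem (fun i => zpow_ne_zero i (inv_ne_zero h2))
    (Kunit_zpow_mul_Fgen hq0) hΩ
  refine Uq_submodule_eq_top (Submodule.subset_span ?_) (lift _ ?_) (lift _ ?_)
    (lift _ (hw _ ?_)) (lift _ (hw _ ?_))
  · exact ⟨Finsupp.single 0 1, 0, by simp [weightZero_single]⟩
  · rintro x ⟨p, n, rfl | rfl⟩
    · obtain ⟨p', hp'⟩ := hmE p
      exact ⟨p', n + 1, Or.inl (by rw [← mul_assoc, hp', mul_assoc, pow_succ'])⟩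
    · obtain ⟨p', hp'⟩ := hmE p
      cases n with
      | zero => exact ⟨p', 1, Or.inl (by rw [pow_zero, mul_one, hp', pow_one])⟩
      | succ n =>
        obtain ⟨r, hr⟩ := Egen_mul_Fgen_mem h1
        obtain ⟨s, hs⟩ := weightZero_mul hΩ p' r
        refine ⟨s, n, Or.inr ?_⟩
        rw [← mul_assoc, hp', pow_succ', ← hs, hr]
        simp only [mul_assoc]
  · rintro x ⟨p, n, rfl | rfl⟩
    · obtain ⟨p', hp'⟩ := hmF p
      cases n with
      | zero => exact ⟨p', 1, Or.inr (by rw [pow_zero, mul_one, hp', pow_one])⟩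
      | succ n =>
        obtain ⟨r, hr⟩ := Fgen_mul_Egen_mem (q := q) (m := m)
        obtain ⟨s, hs⟩ := weightZero_mul hΩ p' r
        refine ⟨s, n, Or.inl ?_⟩
        rw [← mul_assoc, hp', pow_succ', ← hs, hr]
        simp only [mul_assoc]
    · obtain ⟨p', hp'⟩ := hmF p
      exact ⟨p', n + 1, Or.inr (by rw [← mul_assoc, hp', mul_assoc, pow_succ'])⟩
  · simpa [Kunit_val] using Kunit_zpow_mem (q := q) (m := m) 1
  · simpa [Kunit_inv_val] using Kunit_zpow_mem (q := q) (m := m) (-1)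

/-- Conjugation by `K`. -/
def conjK (q : ℂ) (m : ℕ) : Module.End ℂ (Uq q m) :=
  (LinearMap.mulLeft ℂ (Kgen q m)).comp (LinearMap.mulRight ℂ (Kinvgen q m))

lemma mem_eigenspace_conjK {x : Uq q m} {c : ℂ} (h : Kgen q m * x = c • (x * Kgen q m)) :
    x ∈ (conjK q m).eigenspace c := by
  rw [Module.End.mem_eigenspace_iff]
  simp only [conjK, LinearMap.comp_apply, LinearMap.mulLeft_apply, LinearMap.mulRight_apply]
  rw [← mul_assoc, h, smul_mul_assoc, mul_assoc, Kgen_mul_Kinvgen, mul_one]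

lemma Kgen_commute_weightZero (hq0 : q ≠ 0) (p : ℤ →₀ Polynomial ℂ) :
    Commute (Kgen q m) (weightZero q m p) := by
  induction p using Finsupp.induction_linear with
  | zero => simp
  | add f g hf hg => rw [map_add]; exact hf.add_right hg
  | single i p =>
    rw [weightZero_single]
    refine Commute.mul_right ?_ ?_
    · exact (Commute.refl (Kunit q m)).zpow_right i |>.units_val
    · have hp := Polynomial.aeval_mem_adjoin_singleton ℂ (Casimir q m) (p := p)
      refine Algebra.adjoin_induction (p := fun x _ => Commute (Kgen q m) x) ?_ ?_ ?_ ?_ hp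
      · rintro x rfl
        exact (Casimir_mul_Kgen hq0).symm
      · intro r; exact (Algebra.commutes r _).symm
      · intro x y _ _ hx hy; exact hx.add_right hy
      · intro x y _ _ hx hy; exact hx.mul_right hy

lemma weightZero_mul_pow_mem_eigenspace (hq0 : q ≠ 0) (p : ℤ →₀ Polynomial ℂ) {x : Uq q m}
    {c : ℂ} (h : Kgen q m * x = c • (x * Kgen q m)) (n : ℕ) :
    weightZero q m p * x ^ n ∈ (conjK q m).eigenspace (c ^ n) := by
  apply mem_eigenspace_conjK
  induction n with
  | zero => simpa using (Kgen_commute_weightZero hq0 p).eq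
  | succ n ih =>
    rw [pow_succ, ← mul_assoc _ (x ^ n), ← mul_assoc (Kgen q m), ih, smul_mul_assoc,
      mul_assoc _ (Kgen q m), h, mul_smul_comm, smul_smul, ← mul_assoc, pow_succ]

lemma center_le_range_weightZero (hq0 : q ≠ 0) (hq : ∀ k : ℕ, 0 < k → q ^ k ≠ 1)
    (h1 : q ^ (2 * m) - 1 ≠ 0) {z : Uq q m} (hz : z ∈ Subalgebra.center ℂ (Uq q m)) :
    z ∈ LinearMap.range (weightZero q m) := by
  have htop : LinearMap.range (weightZero q m) ⊔
      (⨆ (c : ℂ) (_ : c ≠ 1), (conjK q m).eigenspace c) = ⊤ := by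
    rw [eq_top_iff, ← span_weight_eq_top hq0 h1, Submodule.span_le]
    have hpow : ∀ n : ℕ, (q ^ 2) ^ (n + 1) ≠ 1 := fun n => by
      rw [← pow_mul]; exact hq _ (by positivity)
    rintro _ ⟨p, n, rfl | rfl⟩
    · cases n with
      | zero => exact Submodule.mem_sup_left ⟨p, by simp⟩
      | succ n =>
        exact Submodule.mem_sup_right (Submodule.mem_iSup_of_mem _ (Submodule.mem_iSup_of_mem
          (hpow n) (weightZero_mul_pow_mem_eigenspace hq0 p Kgen_mul_Egen (n + 1))))
    · cases n with
      | zero => exact Submodule.mem_sup_left ⟨p, by simp⟩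
      | succ n =>
        refine Submodule.mem_sup_right (Submodule.mem_iSup_of_mem _ (Submodule.mem_iSup_of_mem
          ?_ (weightZero_mul_pow_mem_eigenspace hq0 p Kgen_mul_Fgen (n + 1))))
        rw [inv_pow]
        exact inv_ne_one.2 (hpow n)
  obtain ⟨y, ⟨p, rfl⟩, w, hw, hyw⟩ := Submodule.mem_sup.1 (htop ▸ Submodule.mem_top : z ∈ _)
  have hw1 : w ∈ (conjK q m).eigenspace 1 := by
    have : w = z - weightZero q m p := by rw [← hyw]; abel
    rw [this]
    refine sub_mem (mem_eigenspace_conjK ?_) (mem_eigenspace_conjK ?_)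
    · rw [one_smul]; exact Subalgebra.mem_center_iff.1 hz _
    · rw [one_smul]; exact (Kgen_commute_weightZero hq0 p).eq
  have hw0 : w = 0 :=
    Submodule.disjoint_def.1 ((Module.End.eigenspaces_iSupIndep (conjK q m)) 1) w hw1 hw
  exact ⟨p, by rw [← hyw, hw0, add_zero]⟩

end Decomposition

lemma lmul_pi_apply (g f : ℤ → ℂ) (n : ℤ) : Algebra.lmul ℂ (ℤ → ℂ) g f n = g n * f n := rfl

/-- The action of the generators on functions `ℤ → ℂ` with `K` acting diagonally with
eigenvalues `q ^ (2 * n) * k` and `Ω` acting by the scalar `w`. -/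
def weightAction (q : ℂ) (m : ℕ) (k w : ℂ) : UqGen → Module.End ℂ (ℤ → ℂ)
  | .E => LinearMap.funLeft ℂ ℂ fun n => n - 1
  | .F => Algebra.lmul ℂ (ℤ → ℂ) (fun n => w -
      ((q ^ (2 * m) - 1) * (q - q⁻¹))⁻¹ *
        (q ^ (2 * m) * ((q ^ 2) ^ n * k) ^ m + (((q ^ 2) ^ n * k)⁻¹) ^ m)) *
      LinearMap.funLeft ℂ ℂ fun n => n + 1
  | .K => Algebra.lmul ℂ (ℤ → ℂ) fun n => (q ^ 2) ^ n * k
  | .Kinv => Algebra.lmul ℂ (ℤ → ℂ) fun n => ((q ^ 2) ^ n * k)⁻¹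

/-- The weight representation of `Uq q m` on functions `ℤ → ℂ`. -/
def weightRep (q : ℂ) (m : ℕ) (k w : ℂ) (hq0 : q ≠ 0) (h1 : q ^ (2 * m) - 1 ≠ 0) (hk : k ≠ 0) :
    Uq q m →ₐ[ℂ] Module.End ℂ (ℤ → ℂ) :=
  RingQuot.liftAlgHom ℂ ⟨FreeAlgebra.lift ℂ (weightAction q m k w), by
    have h2 : q ^ 2 ≠ 0 := pow_ne_zero 2 hq0
    have hne : ∀ n : ℤ, (q ^ 2) ^ n * k ≠ 0 := fun n => mul_ne_zero (zpow_ne_zero n h2) hk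
    rintro _ _ (_ | _ | _ | _ | _)
    · simp only [map_mul, map_smul, FreeAlgebra.lift_ι_apply, weightAction]
      refine LinearMap.ext fun f => funext fun n => ?_
      simp [LinearMap.funLeft_apply, zpow_sub_one₀ h2]
      field_simp
    · simp only [map_mul, map_smul, FreeAlgebra.lift_ι_apply, weightAction]
      refine LinearMap.ext fun f => funext fun n => ?_
      simp [LinearMap.funLeft_apply, zpow_add_one₀ h2]
      field_simp
    · simp only [map_mul, map_one, FreeAlgebra.lift_ι_apply, weightAction]
      refine LinearMap.ext fun f => funext fun n => ?_
      simp only [Module.End.mul_apply, Module.End.one_apply, lmul_pi_apply]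
      rw [← mul_assoc, mul_inv_cancel₀ (hne n), one_mul]
    · simp only [map_mul, map_one, FreeAlgebra.lift_ι_apply, weightAction]
      refine LinearMap.ext fun f => funext fun n => ?_
      simp only [Module.End.mul_apply, Module.End.one_apply, lmul_pi_apply]
      rw [← mul_assoc, inv_mul_cancel₀ (hne n), one_mul]
    · simp only [map_mul, map_smul, map_sub, map_pow, FreeAlgebra.lift_ι_apply, weightAction]
      simp only [← map_pow]
      refine LinearMap.ext fun f => funext fun n => ?_
      simp only [Module.End.mul_apply, lmul_pi_apply, LinearMap.sub_apply,
        LinearMap.smul_apply, Pi.sub_apply, Pi.smul_apply, Pi.pow_apply, smul_eq_mul,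
        LinearMap.funLeft_apply, sub_add_cancel, add_sub_cancel_right]
      have e : (q ^ 2) ^ n * k = q ^ 2 * ((q ^ 2) ^ (n - 1) * k) := by
        rw [zpow_sub_one₀ h2]; field_simp
      have hn := hne (n - 1)
      rw [e]
      generalize (q ^ 2) ^ (n - 1) * k = x at hn
      have h3 : (q - q⁻¹)⁻¹ = ((q ^ (2 * m) - 1) * (q - q⁻¹))⁻¹ * (q ^ (2 * m) - 1) := by
        rw [mul_inv]; field_simp
      rw [h3]
      generalize ((q ^ (2 * m) - 1) * (q - q⁻¹))⁻¹ = c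
      simp only [mul_pow, mul_inv, inv_pow, ← pow_mul]
      have hqm : q ^ (2 * m) ≠ 0 := pow_ne_zero _ hq0
      have hxm : x ^ m ≠ 0 := pow_ne_zero _ hn
      field_simp
      ring⟩

section Rep

variable {q : ℂ} {m : ℕ} {k w : ℂ} (hq0 : q ≠ 0) (h1 : q ^ (2 * m) - 1 ≠ 0) (hk : k ≠ 0)

lemma weightRep_gen (g : UqGen) :
    weightRep q m k w hq0 h1 hk (RingQuot.mkAlgHom ℂ (UqRel q m) (FreeAlgebra.ι ℂ g)) =
      weightAction q m k w g := by
  simp [weightRep]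

lemma weightRep_Casimir :
    weightRep q m k w hq0 h1 hk (Casimir q m) = algebraMap ℂ _ w := by
  simp only [Casimir, Fgen, Egen, Kgen, Kinvgen, map_add, map_mul, map_smul, map_pow,
    weightRep_gen, weightAction]
  simp only [← map_pow]
  refine LinearMap.ext fun f => funext fun n => ?_
  simp only [Module.End.mul_apply, lmul_pi_apply, LinearMap.add_apply,
    LinearMap.smul_apply, Pi.add_apply, Pi.smul_apply, Pi.pow_apply, smul_eq_mul,
    LinearMap.funLeft_apply, add_sub_cancel_right, Module.algebraMap_end_apply]
  ring

lemma weightRep_Kunit_zpow (i : ℤ) :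
    weightRep q m k w hq0 h1 hk ((Kunit q m ^ i : (Uq q m)ˣ) : Uq q m) =
      Algebra.lmul ℂ (ℤ → ℂ) fun n => ((q ^ 2) ^ n * k) ^ i := by
  have hne : ∀ n : ℤ, (q ^ 2) ^ n * k ≠ 0 :=
    fun n => mul_ne_zero (zpow_ne_zero n (pow_ne_zero 2 hq0)) hk
  induction i with
  | zero =>
    simp only [zpow_zero, Units.val_one, map_one]
    exact (map_one (Algebra.lmul ℂ (ℤ → ℂ))).symm
  | succ i ih =>
    rw [zpow_add_one, Units.val_mul, map_mul, ih, Kunit_val, Kgen, weightRep_gen, weightAction,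
      ← map_mul]
    exact congrArg _ (funext fun n => (zpow_add_one₀ (hne n) _).symm)
  | pred i ih =>
    rw [zpow_sub_one, Units.val_mul, map_mul, ih, Kunit_inv_val, Kinvgen, weightRep_gen,
      weightAction, ← map_mul]
    exact congrArg _ (funext fun n => (zpow_sub_one₀ (hne n) _).symm)

lemma weightRep_weightZero (p : ℤ →₀ Polynomial ℂ) (f : ℤ → ℂ) (n : ℤ) :
    weightRep q m k w hq0 h1 hk (weightZero q m p) f n =
      p.sum fun i r => ((q ^ 2) ^ n * k) ^ i * r.eval w * f n := by
  induction p using Finsupp.induction_linear with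
  | zero => simp
  | add f g hf hg =>
    rw [Finsupp.sum_add_index' (by simp) (by intros; simp [mul_add, add_mul]), ← hf, ← hg,
      map_add, map_add]
    rfl
  | single i p =>
    rw [weightZero_single, map_mul, weightRep_Kunit_zpow, ← Polynomial.aeval_algHom_apply,
      weightRep_Casimir, Polynomial.aeval_algebraMap_apply, Finsupp.sum_single_index (by simp)]
    simp [mul_assoc, mul_left_comm]

end Rep

lemma eq_zero_of_forall_sum_zpow (s : Finset ℤ) (c : ℤ → ℂ)
    (h : ∀ k : ℂ, k ≠ 0 → ∑ i ∈ s, c i * k ^ i = 0) : ∀ i ∈ s, c i = 0 := by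
  let χ : ℤ → ℂˣ →* ℂ := fun i => (Units.coeHom ℂ).comp (zpowGroupHom i)
  have hχ : Function.Injective χ := by
    intro i j hij
    have h2 : ((2 : ℝ) : ℂ) ^ i = ((2 : ℝ) : ℂ) ^ j := by
      simpa [χ] using DFunLike.congr_fun hij (Units.mk0 (2 : ℂ) two_ne_zero)
    exact zpow_right_injective₀ (a := (2 : ℝ)) (by norm_num) (by norm_num) (by exact_mod_cast h2)
  refine linearIndependent_iff'.1 ((linearIndependent_monoidHom ℂˣ ℂ).comp χ hχ) s c ?_
  ext k
  simpa [χ] using h k k.ne_zero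

/-- If `q` is not a root of unity, the center of `U_q(f_m(K))` equals
`ℂ[Ω]`, the subalgebra generated by the Casimir element `Ω`. -/
theorem stmt7 (q : ℂ) (m : ℕ) (hm : 1 ≤ m) (hq0 : q ≠ 0)
    (hq : ∀ k : ℕ, 0 < k → q ^ k ≠ 1) :
    Subalgebra.center ℂ (Uq q m) =
      Algebra.adjoin ℂ ({Casimir q m} : Set (Uq q m)) := by
  have h1 : q ^ (2 * m) - 1 ≠ 0 := sub_ne_zero.2 (hq _ (by positivity))
  refine le_antisymm (fun z hz => ?_)
    (Algebra.adjoin_le (Set.singleton_subset_iff.2 (Casimir_mem_center hq0 h1)))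
  obtain ⟨p, rfl⟩ := center_le_range_weightZero hq0 hq h1 hz
  have hp : ∀ i ≠ 0, p i = 0 := by
    intro i hi
    refine Polynomial.funext fun w => ?_
    have hsum : ∀ k : ℂ, k ≠ 0 →
        ∑ i ∈ p.support, ((p i).eval w * (((q ^ 2)⁻¹) ^ i - 1)) * k ^ i = 0 := by
      intro k hk
      have hcomm := congrArg (weightRep q m k w hq0 h1 hk)
        (Subalgebra.mem_center_iff.1 hz (Egen q m))
      have h0 := congrFun (LinearMap.congr_fun hcomm 1) 0
      rw [map_mul, map_mul, Egen, weightRep_gen] at h0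
      simp only [Module.End.mul_apply, weightAction, LinearMap.funLeft_apply,
        weightRep_weightZero, Finsupp.sum, Pi.one_apply, mul_one, zero_sub, zpow_neg, zpow_one,
        zpow_zero, one_mul] at h0
      rw [← sub_eq_zero, ← Finset.sum_sub_distrib] at h0
      rw [← h0]
      refine Finset.sum_congr rfl fun i _ => ?_
      rw [mul_zpow]
      ring
    by_cases his : i ∈ p.support
    · have h2 := eq_zero_of_forall_sum_zpow _ _ hsum i his
      have hne : ((q ^ 2)⁻¹) ^ i - 1 ≠ 0 := by
        rw [sub_ne_zero, inv_zpow, Ne, inv_eq_one]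
        intro h
        have hnat : (q ^ 2) ^ i.natAbs = 1 := by
          rcases Int.natAbs_eq i with hi' | hi' <;> rw [hi'] at h
          · rwa [zpow_natCast] at h
          · rwa [zpow_neg, zpow_natCast, inv_eq_one] at h
        rw [← pow_mul] at hnat
        exact hq _ (mul_pos two_pos (Int.natAbs_pos.2 hi)) hnat
      simpa using (mul_eq_zero.1 h2).resolve_right hne
    · simp [Finsupp.notMem_support_iff.1 his]
  have : p = Finsupp.single 0 (p 0) := by
    ext1 i
    rcases eq_or_ne i 0 with rfl | hi
    · simp
    · rw [hp i hi, Finsupp.single_eq_of_ne hi]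
  rw [this, weightZero_single]
  simp [Polynomial.aeval_mem_adjoin_singleton]
end
end

section
/- Let π: U_q(f(K)) → U_q(F, K^{±1}) be the projection along the decomposition U_q(f(K)) = U_q(F, K^{±1}) ⊕ U_q(f(K))U_{q,η}(E), writing u^η = π(u). Then for all u ∈ U_q(f(K)) and v in the center Z(U_q(f(K))), one has (uv)^η = u^η v^η. -/
noncomputable section

open FreeAlgebra in
/-- The defining relations of `U_q(f(K))`, where the Laurent polynomial `f` is given by
its finitely supported coefficient function `f : ℤ →₀ ℂ`. -/
inductive UqfRel (q : ℂ) (f : ℤ →₀ ℂ) : FreeAlgebra ℂ UqGen → FreeAlgebra ℂ UqGen → Prop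
  | KE : UqfRel q f (ι ℂ UqGen.K * ι ℂ UqGen.E) (q ^ 2 • (ι ℂ UqGen.E * ι ℂ UqGen.K))
  | KF : UqfRel q f (ι ℂ UqGen.K * ι ℂ UqGen.F) ((q ^ 2)⁻¹ • (ι ℂ UqGen.F * ι ℂ UqGen.K))
  | KKinv : UqfRel q f (ι ℂ UqGen.K * ι ℂ UqGen.Kinv) 1
  | KinvK : UqfRel q f (ι ℂ UqGen.Kinv * ι ℂ UqGen.K) 1
  | EF : UqfRel q f (ι ℂ UqGen.E * ι ℂ UqGen.F - ι ℂ UqGen.F * ι ℂ UqGen.E)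
      (f.sum fun i c => c • lpow (ι ℂ UqGen.K) (ι ℂ UqGen.Kinv) i)

/-- The algebra `U_q(f(K))`. -/
abbrev Uqf (q : ℂ) (f : ℤ →₀ ℂ) : Type := RingQuot (UqfRel q f)

def Eg (q : ℂ) (f : ℤ →₀ ℂ) : Uqf q f := RingQuot.mkAlgHom ℂ (UqfRel q f) (FreeAlgebra.ι ℂ UqGen.E)
def Fg (q : ℂ) (f : ℤ →₀ ℂ) : Uqf q f := RingQuot.mkAlgHom ℂ (UqfRel q f) (FreeAlgebra.ι ℂ UqGen.F)
def Kg (q : ℂ) (f : ℤ →₀ ℂ) : Uqf q f := RingQuot.mkAlgHom ℂ (UqfRel q f) (FreeAlgebra.ι ℂ UqGen.K)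
def Kinvg (q : ℂ) (f : ℤ →₀ ℂ) : Uqf q f := RingQuot.mkAlgHom ℂ (UqfRel q f) (FreeAlgebra.ι ℂ UqGen.Kinv)

theorem map_lpow {A B G : Type*} [Monoid A] [Monoid B] [FunLike G A B] [MonoidHomClass G A B]
    (φ : G) (x y : A) (n : ℤ) : φ (lpow x y n) = lpow (φ x) (φ y) n := by
  unfold lpow
  split_ifs <;> simp

theorem commute_lpow {A : Type*} [Monoid A] {a x y : A} (hx : Commute a x) (hy : Commute a y)
    (n : ℤ) : Commute a (lpow x y n) := by
  unfold lpow
  split_ifs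
  · exact hx.pow_right _
  · exact hy.pow_right _

theorem mul_pow_of_mul_eq_smul {A : Type*} [Ring A] [Algebra ℂ A] {x y : A} {t : ℂ}
    (h : x * y = t • (y * x)) (n : ℕ) : x * y ^ n = t ^ n • (y ^ n * x) := by
  induction n with
  | zero => simp
  | succ n ih =>
    rw [pow_succ, ← mul_assoc, ih, smul_mul_assoc, mul_assoc, h, mul_smul_comm, smul_smul,
      ← mul_assoc, ← pow_succ, ← pow_succ]

namespace Whittaker

/-- The underlying space of the universal Whittaker module: the basis vector indexed by `(i, j)`
stands for `F ^ i K ^ j` applied to the cyclic vector. -/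
abbrev Space : Type := (ℕ × ℤ) →₀ ℂ

/-- The basis vector `F ^ i K ^ j`. -/
abbrev vec (i : ℕ) (j : ℤ) : Space := Finsupp.single (i, j) 1

/-- The linear endomorphism with prescribed values on the basis. -/
def extend {M : Type*} [AddCommGroup M] [Module ℂ M] (g : ℕ → ℤ → M) : Space →ₗ[ℂ] M :=
  Finsupp.linearCombination ℂ fun p => g p.1 p.2

@[simp]
theorem extend_vec {M : Type*} [AddCommGroup M] [Module ℂ M] (g : ℕ → ℤ → M) (i : ℕ) (j : ℤ) :
    extend g (vec i j) = g i j := by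
  simp [extend, vec]

theorem hom_ext {M : Type*} [AddCommGroup M] [Module ℂ M] {a b : Space →ₗ[ℂ] M}
    (h : ∀ i j, a (vec i j) = b (vec i j)) : a = b :=
  Finsupp.lhom_ext' fun p => LinearMap.ext_ring (h p.1 p.2)

/-- The action of `F`. -/
def opF : Module.End ℂ Space := extend fun i j => vec (i + 1) j

/-- The action of `K`, where `t = q⁻²`. -/
def opK (t : ℂ) : Module.End ℂ Space := extend fun i j => t ^ i • vec i (j + 1)

/-- The action of `K⁻¹`, where `t = q⁻²`. -/
def opKinv (t : ℂ) : Module.End ℂ Space := extend fun i j => (t ^ i)⁻¹ • vec i (j - 1)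

/-- The action of `f(K)`. -/
def opf (t : ℂ) (f : ℤ →₀ ℂ) : Module.End ℂ Space :=
  f.sum fun i c => c • lpow (opK t) (opKinv t) i

/-- The vector `E F ^ i K ^ j`, computed by moving `E` to the right. -/
def vecE (t c : ℂ) (f : ℤ →₀ ℂ) : ℕ → ℤ → Space
  | 0, j => (c * t ^ j) • vec 0 j
  | i + 1, j => opF (vecE t c f i j) + opf t f (vec i j)

/-- The action of `E`. -/
def opE (t c : ℂ) (f : ℤ →₀ ℂ) : Module.End ℂ Space := extend (vecE t c f)

theorem opK_mul_opKinv {t : ℂ} (ht : t ≠ 0) : opK t * opKinv t = 1 :=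
  hom_ext fun i j => by simp [opK, opKinv, smul_smul, ht, -Finsupp.smul_single]

theorem opKinv_mul_opK {t : ℂ} (ht : t ≠ 0) : opKinv t * opK t = 1 :=
  hom_ext fun i j => by simp [opK, opKinv, smul_smul, ht, -Finsupp.smul_single]

theorem opK_mul_opF (t : ℂ) : opK t * opF = t • (opF * opK t) :=
  hom_ext fun i j => by simp [opK, opF, smul_smul, pow_succ', -Finsupp.smul_single]

theorem opE_mul_opF (t c : ℂ) (f : ℤ →₀ ℂ) :
    opE t c f * opF = opF * opE t c f + opf t f :=
  hom_ext fun i j => by simp [opE, opF, vecE, -Finsupp.smul_single]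

theorem commute_opK_opf {t : ℂ} (ht : t ≠ 0) (f : ℤ →₀ ℂ) : Commute (opK t) (opf t f) := by
  unfold opf Finsupp.sum
  refine Commute.sum_right _ _ _ fun i _ => (commute_lpow (Commute.refl _) ?_ i).smul_right _
  rw [Commute, SemiconjBy, opK_mul_opKinv ht, opKinv_mul_opK ht]

theorem opE_mul_opK {t : ℂ} (ht : t ≠ 0) (c : ℂ) (f : ℤ →₀ ℂ) :
    opE t c f * opK t = t • (opK t * opE t c f) := by
  refine hom_ext fun i => ?_
  induction i with
  | zero =>
    intro j
    simp only [opE, opK, vecE, Module.End.mul_apply, LinearMap.smul_apply, extend_vec, map_smul,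
      smul_smul, zpow_add_one₀ ht]
    congr 1
    ring
  | succ i ih =>
    intro j
    have hF : vec (i + 1) j = opF (vec i j) := by simp [opF]
    have h1 : opE t c f * opK t * opF = t • (opF * (opE t c f * opK t) + opf t f * opK t) := by
      rw [mul_assoc, opK_mul_opF, mul_smul_comm, ← mul_assoc, opE_mul_opF, add_mul, mul_assoc]
    have h2 : opK t * opE t c f * opF =
        t • (opF * (opK t * opE t c f)) + opf t f * opK t := by
      rw [mul_assoc, opE_mul_opF, mul_add, ← mul_assoc, opK_mul_opF, smul_mul_assoc, mul_assoc,
        (commute_opK_opf ht f).eq]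
    rw [hF, ← Module.End.mul_apply, ← Module.End.mul_apply, h1, smul_mul_assoc, h2]
    simp only [LinearMap.smul_apply, LinearMap.add_apply, Module.End.mul_apply (f := opF), ih,
      map_smul]

/-- The action of the generators. -/
def op (t c : ℂ) (f : ℤ →₀ ℂ) : UqGen → Module.End ℂ Space
  | .E => opE t c f
  | .F => opF
  | .K => opK t
  | .Kinv => opKinv t

theorem lift_op_eq_of_rel {q : ℂ} (hq : q ≠ 0) (c : ℂ) (f : ℤ →₀ ℂ)
    ⦃x y : FreeAlgebra ℂ UqGen⦄ (h : UqfRel q f x y) :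
    FreeAlgebra.lift ℂ (op (q ^ 2)⁻¹ c f) x = FreeAlgebra.lift ℂ (op (q ^ 2)⁻¹ c f) y := by
  have hq2 : q ^ 2 ≠ 0 := pow_ne_zero 2 hq
  have ht : (q ^ 2)⁻¹ ≠ 0 := inv_ne_zero hq2
  cases h with
  | KE => simp [op, opE_mul_opK ht, smul_smul, hq]
  | KF => simp only [map_mul, map_smul, FreeAlgebra.lift_ι_apply, op, opK_mul_opF]
  | KKinv => simp [op, opK_mul_opKinv ht]
  | KinvK => simp [op, opKinv_mul_opK ht]
  | EF =>
    simp [op, opE_mul_opF, opf, Finsupp.sum, map_lpow]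
    exact add_sub_cancel_left (opF * opE (q ^ 2)⁻¹ c f) (opf (q ^ 2)⁻¹ f)

/-- The universal Whittaker module of `U_q(f(K))` on which `E` has eigenvalue `c` at the cyclic
vector. -/
def rep {q : ℂ} (hq : q ≠ 0) (c : ℂ) (f : ℤ →₀ ℂ) : Uqf q f →ₐ[ℂ] Module.End ℂ Space :=
  RingQuot.liftAlgHom ℂ ⟨FreeAlgebra.lift ℂ (op (q ^ 2)⁻¹ c f), lift_op_eq_of_rel hq c f⟩

variable {q : ℂ} (hq : q ≠ 0) (c : ℂ) (f : ℤ →₀ ℂ)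

theorem rep_E : rep hq c f (Eg q f) = opE (q ^ 2)⁻¹ c f := by simp [rep, Eg, op]

theorem rep_F : rep hq c f (Fg q f) = opF := by simp [rep, Fg, op]

theorem rep_K : rep hq c f (Kg q f) = opK (q ^ 2)⁻¹ := by simp [rep, Kg, op]

theorem rep_Kinv : rep hq c f (Kinvg q f) = opKinv (q ^ 2)⁻¹ := by simp [rep, Kinvg, op]

theorem Kg_mul_Kinvg : Kg q f * Kinvg q f = 1 := by
  simpa [Kg, Kinvg] using RingQuot.mkAlgHom_rel ℂ (UqfRel.KKinv (q := q) (f := f))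

theorem Kinvg_mul_Kg : Kinvg q f * Kg q f = 1 := by
  simpa [Kg, Kinvg] using RingQuot.mkAlgHom_rel ℂ (UqfRel.KinvK (q := q) (f := f))

theorem Kg_mul_Fg : Kg q f * Fg q f = (q ^ 2)⁻¹ • (Fg q f * Kg q f) := by
  simpa only [map_mul, map_smul, Kg, Fg] using RingQuot.mkAlgHom_rel ℂ (UqfRel.KF (q := q) (f := f))

/-- The generator `K` as a unit. -/
def unitK (q : ℂ) (f : ℤ →₀ ℂ) : (Uqf q f)ˣ :=
  ⟨Kg q f, Kinvg q f, Kg_mul_Kinvg f, Kinvg_mul_Kg f⟩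

/-- The linear map sending the basis vector indexed by `(i, j)` to `F ^ i K ^ j`. -/
def toUqf (q : ℂ) (f : ℤ →₀ ℂ) : Space →ₗ[ℂ] Uqf q f :=
  extend fun i j => Fg q f ^ i * ((unitK q f ^ j : (Uqf q f)ˣ) : Uqf q f)

theorem Kg_mul_Fg_pow (i : ℕ) :
    Kg q f * Fg q f ^ i = ((q ^ 2)⁻¹) ^ i • (Fg q f ^ i * Kg q f) :=
  mul_pow_of_mul_eq_smul (Kg_mul_Fg f) i

theorem Kinvg_mul_Fg_pow {q : ℂ} (hq : q ≠ 0) (f : ℤ →₀ ℂ) (i : ℕ) :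
    Kinvg q f * Fg q f ^ i = (((q ^ 2)⁻¹) ^ i)⁻¹ • (Fg q f ^ i * Kinvg q f) := by
  have ht : ((q ^ 2)⁻¹) ^ i ≠ 0 := pow_ne_zero _ (inv_ne_zero (pow_ne_zero 2 hq))
  rw [eq_inv_smul_iff₀ ht]
  calc ((q ^ 2)⁻¹) ^ i • (Kinvg q f * Fg q f ^ i)
      = Kinvg q f * (((q ^ 2)⁻¹) ^ i • (Fg q f ^ i * Kg q f)) * Kinvg q f := by
        rw [mul_smul_comm, smul_mul_assoc, mul_assoc, mul_assoc, Kg_mul_Kinvg, mul_one]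
    _ = Fg q f ^ i * Kinvg q f := by
        rw [← Kg_mul_Fg_pow, ← mul_assoc, Kinvg_mul_Kg, one_mul]

theorem toUqf_rep {b : Uqf q f}
    (hb : b ∈ Algebra.adjoin ℂ ({Fg q f, Kg q f, Kinvg q f} : Set (Uqf q f))) (m : Space) :
    toUqf q f (rep hq c f b m) = b * toUqf q f m := by
  induction hb using Algebra.adjoin_induction generalizing m with
  | mem x hx =>
    have hlin : ∀ g : Uqf q f, (∀ i j, toUqf q f (rep hq c f g (vec i j)) =
        g * toUqf q f (vec i j)) → toUqf q f (rep hq c f g m) = g * toUqf q f m := fun g hg =>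
      LinearMap.congr_fun (hom_ext (a := toUqf q f ∘ₗ rep hq c f g)
        (b := LinearMap.mulLeft ℂ g ∘ₗ toUqf q f) hg) m
    have hK : Kg q f = (unitK q f : Uqf q f) := rfl
    have hKinv : Kinvg q f = ((unitK q f)⁻¹ : (Uqf q f)ˣ) := rfl
    refine hlin x fun i j => ?_
    rcases hx with rfl | rfl | rfl
    · rw [rep_F]
      simp only [opF, toUqf, extend_vec, pow_succ', mul_assoc]
    · rw [rep_K]
      simp only [opK, toUqf, extend_vec, map_smul]
      rw [← mul_assoc, Kg_mul_Fg_pow, smul_mul_assoc, mul_assoc, hK, ← Units.val_mul,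
        ← zpow_one_add, add_comm]
    · rw [rep_Kinv]
      simp only [opKinv, toUqf, extend_vec, map_smul]
      rw [← mul_assoc, Kinvg_mul_Fg_pow hq, smul_mul_assoc, mul_assoc, hKinv, ← Units.val_mul,
        sub_eq_neg_add, zpow_add,
        zpow_neg_one]
  | algebraMap r => simp [Algebra.algebraMap_eq_smul_one]
  | add x y _ _ hx hy => simp [hx, hy, add_mul]
  | mul x y _ _ hx hy => simp [hx, hy, mul_assoc]

theorem eq_zero_of_rep_vec_eq_zero {b : Uqf q f}
    (hb : b ∈ Algebra.adjoin ℂ ({Fg q f, Kg q f, Kinvg q f} : Set (Uqf q f)))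
    (h : rep hq c f b (vec 0 0) = 0) : b = 0 := by
  simpa [h, toUqf, -Finsupp.single_zero] using (toUqf_rep hq c f hb (vec 0 0)).symm

theorem rep_adjoin_Eg (η : ↥(Algebra.adjoin ℂ ({Eg q f} : Set (Uqf q f))) →ₐ[ℂ] ℂ)
    {x : Uqf q f} (hx : x ∈ Algebra.adjoin ℂ ({Eg q f} : Set (Uqf q f))) :
    rep hq (η ⟨Eg q f, Algebra.subset_adjoin (Set.mem_singleton _)⟩) f x (vec 0 0) =
      η ⟨x, hx⟩ • vec 0 0 := by
  induction hx using Algebra.adjoin_induction with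
  | mem x hx =>
    obtain rfl : x = Eg q f := hx
    rw [rep_E]
    simp only [opE, extend_vec, vecE, zpow_zero, mul_one]
  | algebraMap r =>
    rw [AlgHom.commutes, Module.algebraMap_end_apply]
    congr 1
    exact (η.commutes r).symm
  | add x y hx hy ihx ihy =>
    rw [map_add, LinearMap.add_apply, ihx, ihy, ← add_smul, ← map_add]
    rfl
  | mul x y hx hy ihx ihy =>
    rw [map_mul, Module.End.mul_apply, ihy, map_smul, ihx, smul_smul, mul_comm, ← map_mul]
    rfl

theorem rep_vec_eq_zero_of_mem_span
    (η : ↥(Algebra.adjoin ℂ ({Eg q f} : Set (Uqf q f))) →ₐ[ℂ] ℂ) {z : Uqf q f}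
    (hz : z ∈ Submodule.span ℂ {z : Uqf q f |
        ∃ (w : Uqf q f) (x : ↥(Algebra.adjoin ℂ ({Eg q f} : Set (Uqf q f)))),
          η x = 0 ∧ z = w * (x : Uqf q f)}) :
    rep hq (η ⟨Eg q f, Algebra.subset_adjoin (Set.mem_singleton _)⟩) f z (vec 0 0) = 0 := by
  induction hz using Submodule.span_induction with
  | mem z hz =>
    obtain ⟨w, x, hx, rfl⟩ := hz
    rw [map_mul, Module.End.mul_apply, rep_adjoin_Eg hq f η x.2, hx, zero_smul, map_zero]
  | zero => simp
  | add x y _ _ hx hy => rw [map_add, LinearMap.add_apply, hx, hy, add_zero]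
  | smul r x _ hx => rw [map_smul, LinearMap.smul_apply, hx, smul_zero]

end Whittaker

/-- Let `π : U_q(f(K)) → U_q(F, K^{±1})` be the projection along the
decomposition `U_q(f(K)) = U_q(F, K^{±1}) ⊕ U_q(f(K))·U_{q,η}(E)` (characterized by:
`π u` lies in `U_q(F, K^{±1})` and `u - π u` lies in `U_q(f(K))·ker η`), writing
`u^η = π(u)`. Then for all `u ∈ U_q(f(K))` and `v` in the center `Z(U_q(f(K)))`,
one has `(uv)^η = u^η v^η`. -/
theorem stmt10 (q : ℂ) (f : ℤ →₀ ℂ) (hq0 : q ≠ 0) (hq2 : q ^ 2 ≠ 1)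
    (η : ↥(Algebra.adjoin ℂ ({Eg q f} : Set (Uqf q f))) →ₐ[ℂ] ℂ)
    (hη : η ⟨Eg q f, Algebra.subset_adjoin (Set.mem_singleton _)⟩ ≠ 0)
    (π : Uqf q f →ₗ[ℂ] Uqf q f)
    (hπ1 : ∀ u : Uqf q f,
      π u ∈ Algebra.adjoin ℂ ({Fg q f, Kg q f, Kinvg q f} : Set (Uqf q f)))
    (hπ2 : ∀ u : Uqf q f,
      u - π u ∈ Submodule.span ℂ {z : Uqf q f |
        ∃ (w : Uqf q f) (x : ↥(Algebra.adjoin ℂ ({Eg q f} : Set (Uqf q f)))),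
          η x = 0 ∧ z = w * (x : Uqf q f)}) :
    ∀ u v : Uqf q f, v ∈ Subalgebra.center ℂ (Uqf q f) → π (u * v) = π u * π v := by
  intro u v hv
  have hI := fun z => Whittaker.rep_vec_eq_zero_of_mem_span hq0 f η (hπ2 z)
  rw [← sub_eq_zero]
  refine Whittaker.eq_zero_of_rep_vec_eq_zero hq0
    (η ⟨Eg q f, Algebra.subset_adjoin (Set.mem_singleton _)⟩) f
    (sub_mem (hπ1 _) (mul_mem (hπ1 _) (hπ1 _))) ?_
  have hcomm : v * (u - π u) = (u - π u) * v :=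
    (Subalgebra.mem_center_iff.mp hv (u - π u)).symm
  have hdecomp : π (u * v) - π u * π v =
      v * (u - π u) + π u * (v - π v) - (u * v - π (u * v)) := by
    rw [hcomm]
    simp only [sub_mul, mul_sub]
    abel
  rw [hdecomp, map_sub, map_add, map_mul, map_mul, LinearMap.sub_apply, LinearMap.add_apply,
    Module.End.mul_apply, Module.End.mul_apply, hI, hI, hI]
  simp only [map_zero, add_zero, sub_zero]
end
end

section
/- The multiplication map Φ: Ã ⊗ W(F, K^{±1}) → U_q(F, K^{±1}) is an isomorphism of right W(F, K^{±1})-modules, where Ã = C[K, K^{−1}] and W(F, K^{±1}) = C[π(Ω)] with π(Ω) = η(E)F + (q^{2m}K^m + K^{−m})/((q^{2m}−1)(q−q^{−1})). Equivalently, the elements K^j·π(Ω)^i (j ∈ Z, i ≥ 0) form a C-basis of U_q(F, K^{±1}). -/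
noncomputable section

theorem lpow_val_inv {A : Type*} [Monoid A] (u : Aˣ) (n : ℤ) :
    lpow (u : A) ((u⁻¹ : Aˣ) : A) n = ((u ^ n : Aˣ) : A) := by
  unfold lpow
  split_ifs with h
  · lift n to ℕ using h
    simp
  · obtain ⟨k, rfl⟩ : ∃ k : ℕ, n = -k := ⟨(-n).toNat, by omega⟩
    rw [zpow_neg, ← inv_zpow]
    simp

namespace Uq

variable (q : ℂ) (m : ℕ)

theorem Kgen_mul_Kinvgen : Kgen q m * Kinvgen q m = 1 := by
  simpa [Kgen, Kinvgen] using RingQuot.mkAlgHom_rel ℂ (UqRel.KKinv (q := q) (m := m))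

theorem Kinvgen_mul_Kgen : Kinvgen q m * Kgen q m = 1 := by
  simpa [Kgen, Kinvgen] using RingQuot.mkAlgHom_rel ℂ (UqRel.KinvK (q := q) (m := m))

theorem Kgen_mul_Fgen : Kgen q m * Fgen q m = (q ^ 2)⁻¹ • (Fgen q m * Kgen q m) := by
  simpa [Kgen, Fgen] using RingQuot.mkAlgHom_rel ℂ (UqRel.KF (q := q) (m := m))

/-- The generator `K` as a unit of `U_q`. -/
def Kunit : (Uq q m)ˣ :=
  ⟨Kgen q m, Kinvgen q m, Kgen_mul_Kinvgen q m, Kinvgen_mul_Kgen q m⟩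

theorem Kzpow_eq (n : ℤ) : Kzpow q m n = ((Kunit q m ^ n : (Uq q m)ˣ) : Uq q m) :=
  lpow_val_inv (Kunit q m) n

theorem Kzpow_zero : Kzpow q m 0 = 1 := by simp [Kzpow_eq]

theorem Kzpow_add (a b : ℤ) : Kzpow q m (a + b) = Kzpow q m a * Kzpow q m b := by
  simp [Kzpow_eq, zpow_add]

theorem Kzpow_one : Kzpow q m 1 = Kgen q m := by simp [Kzpow_eq, Kunit]

theorem Kzpow_neg_one : Kzpow q m (-1) = Kinvgen q m := by simp [Kzpow_eq, Kunit]

theorem Kzpow_natCast (n : ℕ) : Kzpow q m n = Kgen q m ^ n := by simp [Kzpow_eq, Kunit]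

theorem Kzpow_neg_natCast (n : ℕ) : Kzpow q m (-n) = Kinvgen q m ^ n := by
  rw [Kzpow_eq, zpow_neg, ← inv_zpow]
  simp [Kunit]

variable {q}

theorem Fgen_mul_Kgen (hq0 : q ≠ 0) :
    Fgen q m * Kgen q m = q ^ 2 • (Kgen q m * Fgen q m) := by
  rw [Kgen_mul_Fgen, smul_inv_smul₀ (pow_ne_zero 2 hq0)]

theorem Fgen_mul_Kinvgen :
    Fgen q m * Kinvgen q m = (q ^ 2)⁻¹ • (Kinvgen q m * Fgen q m) := by
  calc Fgen q m * Kinvgen q m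
      = Kinvgen q m * (Kgen q m * Fgen q m) * Kinvgen q m := by
        rw [← mul_assoc, Kinvgen_mul_Kgen, one_mul]
    _ = _ := by
        rw [Kgen_mul_Fgen, mul_smul_comm, smul_mul_assoc, mul_assoc, mul_assoc,
          Kgen_mul_Kinvgen, mul_one]

theorem Fgen_mul_Kzpow (hq0 : q ≠ 0) (n : ℤ) :
    Fgen q m * Kzpow q m n = (q ^ 2) ^ n • (Kzpow q m n * Fgen q m) := by
  have h2 : q ^ 2 ≠ 0 := pow_ne_zero 2 hq0
  induction n using Int.induction_on with
  | zero => simp [Kzpow_zero]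
  | succ n ih =>
    rw [Kzpow_add, ← mul_assoc, ih, Kzpow_one, smul_mul_assoc, mul_assoc, Fgen_mul_Kgen m hq0,
      mul_smul_comm, smul_smul, zpow_add_one₀ h2, mul_assoc]
  | pred n ih =>
    rw [sub_eq_add_neg, Kzpow_add, ← mul_assoc, ih, Kzpow_neg_one, smul_mul_assoc, mul_assoc,
      Fgen_mul_Kinvgen, mul_smul_comm, smul_smul, ← sub_eq_add_neg, zpow_sub_one₀ h2, mul_assoc]

end Uq

section Whittaker

variable (q : ℂ) (m : ℕ) (e a b : ℂ)

/-- The operators by which the generators of `U_q` act on the universal Whittaker module, in its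
basis `K ^ j * Ω ^ i • w` indexed by `(j, i)`. -/
def whittakerGen : UqGen → Module.End ℂ (ℤ × ℕ →₀ ℂ)
  | .E => Finsupp.linearCombination ℂ fun p =>
      ((q ^ 2) ^ (-p.1) * e) • Finsupp.single p (1 : ℂ)
  | .F => Finsupp.linearCombination ℂ fun p =>
      ((q ^ 2) ^ p.1 * e⁻¹) • (Finsupp.single (p.1, p.2 + 1) (1 : ℂ)
        - a • Finsupp.single (p.1 + m, p.2) (1 : ℂ) - b • Finsupp.single (p.1 - m, p.2) (1 : ℂ))
  | .K => Finsupp.linearCombination ℂ fun p => Finsupp.single (p.1 + 1, p.2) (1 : ℂ)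
  | .Kinv => Finsupp.linearCombination ℂ fun p => Finsupp.single (p.1 - 1, p.2) (1 : ℂ)

theorem whittakerGen_E_single (j : ℤ) (i : ℕ) :
    whittakerGen q m e a b .E (Finsupp.single (j, i) 1) =
      ((q ^ 2) ^ (-j) * e) • Finsupp.single (j, i) (1 : ℂ) := by
  simp only [whittakerGen, Finsupp.linearCombination_single, one_smul]

theorem whittakerGen_F_single (j : ℤ) (i : ℕ) :
    whittakerGen q m e a b .F (Finsupp.single (j, i) 1) =
      ((q ^ 2) ^ j * e⁻¹) • (Finsupp.single (j, i + 1) (1 : ℂ)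
        - a • Finsupp.single (j + m, i) (1 : ℂ) - b • Finsupp.single (j - m, i) (1 : ℂ)) := by
  simp only [whittakerGen, Finsupp.linearCombination_single, one_smul]

theorem whittakerGen_K_single (j : ℤ) (i : ℕ) :
    whittakerGen q m e a b .K (Finsupp.single (j, i) 1) = Finsupp.single (j + 1, i) (1 : ℂ) := by
  simp only [whittakerGen, Finsupp.linearCombination_single, one_smul]

theorem whittakerGen_Kinv_single (j : ℤ) (i : ℕ) :
    whittakerGen q m e a b .Kinv (Finsupp.single (j, i) 1) =
      Finsupp.single (j - 1, i) (1 : ℂ) := by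
  simp only [whittakerGen, Finsupp.linearCombination_single, one_smul]

theorem whittakerGen_K_pow_single (n : ℕ) (j : ℤ) (i : ℕ) :
    (whittakerGen q m e a b .K ^ n) (Finsupp.single (j, i) 1) =
      Finsupp.single (j + n, i) (1 : ℂ) := by
  induction n generalizing j with
  | zero => simp
  | succ n ih =>
    rw [pow_succ, Module.End.mul_apply, whittakerGen_K_single, ih]
    congr 2
    push_cast
    ring

theorem whittakerGen_Kinv_pow_single (n : ℕ) (j : ℤ) (i : ℕ) :
    (whittakerGen q m e a b .Kinv ^ n) (Finsupp.single (j, i) 1) =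
      Finsupp.single (j - n, i) (1 : ℂ) := by
  induction n generalizing j with
  | zero => simp
  | succ n ih =>
    rw [pow_succ, Module.End.mul_apply, whittakerGen_Kinv_single, ih]
    congr 2
    push_cast
    ring

theorem end_ext_single {f g : Module.End ℂ (ℤ × ℕ →₀ ℂ)}
    (h : ∀ j i, f (Finsupp.single (j, i) 1) = g (Finsupp.single (j, i) 1)) : f = g :=
  Finsupp.lhom_ext' fun p => LinearMap.ext_ring (h p.1 p.2)

variable {q m e a b}

theorem whittakerGen_rel (hq0 : q ≠ 0) (he : e ≠ 0)
    (ha : a * (1 - ((q ^ 2) ^ m)⁻¹) = (q - q⁻¹)⁻¹) (hb : b * (1 - (q ^ 2) ^ m) = -(q - q⁻¹)⁻¹)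
    {x y : FreeAlgebra ℂ UqGen} (h : UqRel q m x y) :
    FreeAlgebra.lift ℂ (whittakerGen q m e a b) x =
      FreeAlgebra.lift ℂ (whittakerGen q m e a b) y := by
  have h2 : q ^ 2 ≠ 0 := pow_ne_zero 2 hq0
  have ht : (q ^ 2) ^ m ≠ 0 := pow_ne_zero m h2
  refine end_ext_single fun j i => ?_
  have hj : (q ^ 2) ^ j ≠ 0 := zpow_ne_zero j h2
  cases h with
  | KE =>
    simp only [map_mul, map_smul, FreeAlgebra.lift_ι_apply, Module.End.mul_apply,
      LinearMap.smul_apply, whittakerGen_E_single, whittakerGen_K_single, smul_smul]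
    congr 1
    rw [zpow_neg, zpow_neg, zpow_add_one₀ h2]
    field_simp
  | KF =>
    simp only [map_mul, map_smul, map_sub, FreeAlgebra.lift_ι_apply, Module.End.mul_apply,
      LinearMap.smul_apply, whittakerGen_F_single, whittakerGen_K_single, smul_smul]
    congr 1
    · rw [zpow_add_one₀ h2]
      field_simp
    · rw [add_right_comm, sub_add_eq_add_sub]
  | KKinv =>
    simp [whittakerGen_K_single, whittakerGen_Kinv_single]
  | KinvK =>
    simp [whittakerGen_K_single, whittakerGen_Kinv_single]
  | EF =>
    simp only [map_mul, map_smul, map_sub, map_pow, FreeAlgebra.lift_ι_apply,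
      Module.End.mul_apply, LinearMap.smul_apply, LinearMap.sub_apply, whittakerGen_F_single,
      whittakerGen_E_single, whittakerGen_K_pow_single, whittakerGen_Kinv_pow_single, smul_smul]
    have hp : (q ^ 2) ^ (-(j + m)) = ((q ^ 2) ^ j)⁻¹ * ((q ^ 2) ^ m)⁻¹ := by
      rw [zpow_neg, zpow_add₀ h2, zpow_natCast, mul_inv]
    have hn : (q ^ 2) ^ (-(j - m)) = ((q ^ 2) ^ j)⁻¹ * (q ^ 2) ^ m := by
      rw [zpow_neg, zpow_sub₀ h2, zpow_natCast, inv_div, div_eq_inv_mul]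
    have hb' : (q - q⁻¹)⁻¹ = b * ((q ^ 2) ^ m - 1) := by linear_combination hb
    rw [hp, hn, zpow_neg, smul_sub (q - q⁻¹)⁻¹]
    nth_rewrite 1 [← ha]
    rw [hb']
    match_scalars <;> field_simp <;> ring

/-- The universal Whittaker module, as a representation of `U_q`. -/
def whittakerRep (hq0 : q ≠ 0) (he : e ≠ 0)
    (ha : a * (1 - ((q ^ 2) ^ m)⁻¹) = (q - q⁻¹)⁻¹) (hb : b * (1 - (q ^ 2) ^ m) = -(q - q⁻¹)⁻¹) :
    Uq q m →ₐ[ℂ] Module.End ℂ (ℤ × ℕ →₀ ℂ) :=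
  RingQuot.liftAlgHom ℂ ⟨FreeAlgebra.lift ℂ (whittakerGen q m e a b),
    fun _ _ h => whittakerGen_rel hq0 he ha hb h⟩

variable (hq0 : q ≠ 0) (he : e ≠ 0)
  (ha : a * (1 - ((q ^ 2) ^ m)⁻¹) = (q - q⁻¹)⁻¹) (hb : b * (1 - (q ^ 2) ^ m) = -(q - q⁻¹)⁻¹)

theorem whittakerRep_Fgen :
    whittakerRep hq0 he ha hb (Fgen q m) = whittakerGen q m e a b .F := by
  simp [whittakerRep, Fgen]

theorem whittakerRep_Kgen :
    whittakerRep hq0 he ha hb (Kgen q m) = whittakerGen q m e a b .K := by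
  simp [whittakerRep, Kgen]

theorem whittakerRep_Kinvgen :
    whittakerRep hq0 he ha hb (Kinvgen q m) = whittakerGen q m e a b .Kinv := by
  simp [whittakerRep, Kinvgen]

theorem whittakerRep_Kzpow_single (n j : ℤ) (i : ℕ) :
    whittakerRep hq0 he ha hb (Kzpow q m n) (Finsupp.single (j, i) 1) =
      Finsupp.single (j + n, i) (1 : ℂ) := by
  obtain ⟨k, rfl | rfl⟩ := n.eq_nat_or_neg
  · rw [Uq.Kzpow_natCast, map_pow, whittakerRep_Kgen, whittakerGen_K_pow_single]
  · rw [Uq.Kzpow_neg_natCast, map_pow, whittakerRep_Kinvgen, whittakerGen_Kinv_pow_single,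
      sub_eq_add_neg]

theorem whittakerRep_pow_single (i : ℕ) :
    whittakerRep hq0 he ha hb ((e • Fgen q m + a • Kgen q m ^ m + b • Kinvgen q m ^ m) ^ i)
      (Finsupp.single (0, 0) 1) = Finsupp.single (0, i) (1 : ℂ) := by
  induction i with
  | zero => simp
  | succ i ih =>
    rw [pow_succ', map_mul, Module.End.mul_apply, ih]
    simp only [map_add, map_smul, map_pow, whittakerRep_Fgen, whittakerRep_Kgen,
      whittakerRep_Kinvgen, LinearMap.add_apply, LinearMap.smul_apply, whittakerGen_F_single,
      whittakerGen_K_pow_single, whittakerGen_Kinv_pow_single, smul_smul, zpow_zero, one_mul,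
      mul_inv_cancel₀ he, one_smul]
    abel

end Whittaker

theorem linearIndependent_Kzpow_mul_pow {q : ℂ} {m : ℕ} {e a b : ℂ} (hq0 : q ≠ 0) (he : e ≠ 0)
    (ha : a * (1 - ((q ^ 2) ^ m)⁻¹) = (q - q⁻¹)⁻¹) (hb : b * (1 - (q ^ 2) ^ m) = -(q - q⁻¹)⁻¹) :
    LinearIndependent ℂ (fun p : ℤ × ℕ => Kzpow q m p.1 *
      (e • Fgen q m + a • Kgen q m ^ m + b • Kinvgen q m ^ m) ^ p.2) := by
  refine LinearIndependent.of_comp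
    ((LinearMap.applyₗ (Finsupp.single ((0 : ℤ), 0) (1 : ℂ))).comp
      (whittakerRep hq0 he ha hb).toLinearMap) ?_
  convert Finsupp.linearIndependent_single_one ℂ (ℤ × ℕ) using 1
  funext p
  simp only [Function.comp_apply, LinearMap.comp_apply, AlgHom.toLinearMap_apply,
    LinearMap.applyₗ_apply_apply, map_mul, Module.End.mul_apply]
  rw [whittakerRep_pow_single, whittakerRep_Kzpow_single, zero_add]

theorem span_Kzpow_mul_pow {q : ℂ} {m : ℕ} {e : ℂ} (a b : ℂ) (hq0 : q ≠ 0) (he : e ≠ 0) :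
    Submodule.span ℂ (Set.range (fun p : ℤ × ℕ => Kzpow q m p.1 *
      (e • Fgen q m + a • Kgen q m ^ m + b • Kinvgen q m ^ m) ^ p.2)) =
      Subalgebra.toSubmodule
        (Algebra.adjoin ℂ ({Fgen q m, Kgen q m, Kinvgen q m} : Set (Uq q m))) := by
  set P := e • Fgen q m + a • Kgen q m ^ m + b • Kinvgen q m ^ m with hP
  set S := Submodule.span ℂ (Set.range (fun p : ℤ × ℕ => Kzpow q m p.1 * P ^ p.2)) with hS
  set A := Algebra.adjoin ℂ ({Fgen q m, Kgen q m, Kinvgen q m} : Set (Uq q m)) with hA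
  have hFA : Fgen q m ∈ A := Algebra.subset_adjoin (by simp)
  have hKA : Kgen q m ∈ A := Algebra.subset_adjoin (by simp)
  have hKinvA : Kinvgen q m ∈ A := Algebra.subset_adjoin (by simp)
  have mem (j : ℤ) (i : ℕ) : Kzpow q m j * P ^ i ∈ S := Submodule.subset_span ⟨(j, i), rfl⟩
  have mul_mem_of {x : Uq q m} (h : ∀ j i, x * (Kzpow q m j * P ^ i) ∈ S) {y : Uq q m}
      (hy : y ∈ S) : x * y ∈ S := by
    have : S ≤ S.comap (LinearMap.mulLeft ℂ x) :=
      Submodule.span_le.2 (by rintro _ ⟨p, rfl⟩; exact h p.1 p.2)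
    exact this hy
  have hK (n j : ℤ) (i : ℕ) : Kzpow q m n * (Kzpow q m j * P ^ i) ∈ S := by
    rw [← mul_assoc, ← Uq.Kzpow_add]
    exact mem _ _
  have hF (j : ℤ) (i : ℕ) : Fgen q m * (Kzpow q m j * P ^ i) ∈ S := by
    have hFP : Fgen q m = e⁻¹ • (P - a • Kzpow q m m - b • Kzpow q m (-m)) := by
      rw [Uq.Kzpow_natCast, Uq.Kzpow_neg_natCast, eq_inv_smul_iff₀ he, hP]
      abel
    rw [← mul_assoc, Uq.Fgen_mul_Kzpow m hq0, smul_mul_assoc, mul_assoc, hFP, smul_mul_assoc,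
      mul_smul_comm, sub_mul, sub_mul, ← pow_succ', smul_mul_assoc, smul_mul_assoc, mul_sub,
      mul_sub, mul_smul_comm, mul_smul_comm]
    exact S.smul_mem _ (S.smul_mem _ (S.sub_mem (S.sub_mem (mem _ _) (S.smul_mem _ (hK _ _ _)))
      (S.smul_mem _ (hK _ _ _))))
  have hA_mul : ∀ x ∈ A, ∀ y ∈ S, x * y ∈ S := by
    intro x hx
    induction hx using Algebra.adjoin_induction with
    | mem x hx =>
      intro y hy
      rcases hx with rfl | rfl | rfl
      · exact mul_mem_of hF hy
      · exact mul_mem_of (by simpa only [Uq.Kzpow_one] using hK 1) hy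
      · exact mul_mem_of (by simpa only [Uq.Kzpow_neg_one] using hK (-1)) hy
    | algebraMap r =>
      intro y hy
      rw [← Algebra.smul_def]
      exact S.smul_mem r hy
    | add x y _ _ hx hy =>
      intro z hz
      rw [add_mul]
      exact S.add_mem (hx z hz) (hy z hz)
    | mul x y _ _ hx hy =>
      intro z hz
      rw [mul_assoc]
      exact hx _ (hy z hz)
  refine le_antisymm (Submodule.span_le.2 ?_) fun x hx => ?_
  · rintro _ ⟨⟨j, i⟩, rfl⟩
    have hKzpow : Kzpow q m j ∈ A := by
      obtain ⟨k, rfl | rfl⟩ := j.eq_nat_or_neg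
      · rw [Uq.Kzpow_natCast]
        exact A.pow_mem hKA k
      · rw [Uq.Kzpow_neg_natCast]
        exact A.pow_mem hKinvA k
    exact A.mul_mem hKzpow (A.pow_mem (A.add_mem (A.add_mem (A.smul_mem hFA e)
      (A.smul_mem (A.pow_mem hKA m) a)) (A.smul_mem (A.pow_mem hKinvA m) b)) i)
  · have h1 : (1 : Uq q m) ∈ S := by simpa [Uq.Kzpow_zero] using mem 0 0
    simpa using hA_mul x hx 1 h1

/-- The multiplication map `Φ : Ã ⊗ W(F, K^{±1}) → U_q(F, K^{±1})` is an
isomorphism, where `Ã = ℂ[K, K⁻¹]` and `W(F, K^{±1}) = ℂ[π(Ω)]` with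
`π(Ω) = η(E)F + (q^{2m}K^m + K^{-m})/((q^{2m}-1)(q-q⁻¹))`. Equivalently, with
`e = η(E) ≠ 0`, the elements `K^j · π(Ω)^i` (`j ∈ ℤ`, `i ≥ 0`) are linearly
independent and span `U_q(F, K^{±1})`, the subalgebra generated by `F, K, K⁻¹`. -/
theorem stmt13 (q : ℂ) (m : ℕ) (hm : 1 ≤ m) (hq0 : q ≠ 0)
    (hq : ∀ k : ℕ, 0 < k → q ^ k ≠ 1) (e : ℂ) (he : e ≠ 0) :
    LinearIndependent ℂ (fun p : ℤ × ℕ =>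
      Kzpow q m p.1 *
        (e • Fgen q m +
          (((q ^ (2 * m) - 1) * (q - q⁻¹))⁻¹ * q ^ (2 * m)) • Kgen q m ^ m +
          ((q ^ (2 * m) - 1) * (q - q⁻¹))⁻¹ • Kinvgen q m ^ m) ^ p.2) ∧
    Submodule.span ℂ (Set.range (fun p : ℤ × ℕ =>
      Kzpow q m p.1 *
        (e • Fgen q m +
          (((q ^ (2 * m) - 1) * (q - q⁻¹))⁻¹ * q ^ (2 * m)) • Kgen q m ^ m +
          ((q ^ (2 * m) - 1) * (q - q⁻¹))⁻¹ • Kinvgen q m ^ m) ^ p.2)) =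
      Subalgebra.toSubmodule
        (Algebra.adjoin ℂ ({Fgen q m, Kgen q m, Kinvgen q m} : Set (Uq q m))) := by
  have ht : q ^ (2 * m) - 1 ≠ 0 := sub_ne_zero.2 (hq _ (by omega))
  have ht0 : q ^ (2 * m) ≠ 0 := pow_ne_zero _ hq0
  refine ⟨linearIndependent_Kzpow_mul_pow hq0 he ?_ ?_, span_Kzpow_mul_pow _ _ hq0 he⟩
  · rw [← pow_mul, mul_inv]
    field_simp
  · rw [← pow_mul, mul_inv]
    field_simp
    ring
end
end
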